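/- arXiv:2404.08400 — 2 statements merged into one kernel-verified Lean document; each statement's English description precedes it below -/
import Mathlib

section
/- Let q ≥ 2 and n ≥ 4 be integers. Then rn(D_q □ K_n) = 2n(q + 3) − 3. -/
open SimpleGraph Finset

namespace RadioPaper

/-- A radio labelling of `G`: `|f u - f v| ≥ diam G + 1 - d(u,v)` for all distinct `u v`. -/
def IsRadioLabelling {α : Type*} [Fintype α] (G : SimpleGraph α) (f : α → ℕ) : Prop :=
  ∀ u v : α, u ≠ v → G.diam + 1 ≤ Nat.dist (f u) (f v) + G.dist u v

/-- The span of a labelling: the maximum difference between two labels. -/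
noncomputable def spanOf {α : Type*} [Fintype α] (f : α → ℕ) : ℕ :=
  Finset.univ.sup fun p : α × α => Nat.dist (f p.1) (f p.2)

/-- The radio number of `G`: the minimum span of a radio labelling of `G`. -/
noncomputable def radioNumber {α : Type*} [Fintype α] (G : SimpleGraph α) : ℕ :=
  sInf { k | ∃ f : α → ℕ, IsRadioLabelling G f ∧ spanOf f = k }

variable {V : Type*} [Fintype V]

/-- The weight of `G` from `v`. -/
noncomputable def weight (G : SimpleGraph V) (v : V) : ℕ := ∑ u, G.dist u v

/-- The set of weight centers: vertices minimizing the weight. -/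
def weightCenters (G : SimpleGraph V) : Set V := {v | ∀ u, weight G v ≤ weight G u}

/-- The level of a vertex: its distance to the nearest weight center. -/
noncomputable def level (G : SimpleGraph V) (u : V) : ℕ :=
  sInf ((fun x => G.dist u x) '' weightCenters G)

/-- The total level of `G`. -/
noncomputable def totalLevel (G : SimpleGraph V) : ℕ := ∑ u, level G u

/-- `ε(G) = 1` if `G` has a unique weight center, `0` otherwise. -/
noncomputable def epsilon (G : SimpleGraph V) : ℕ :=
  if (weightCenters G).ncard = 1 then 1 else 0

/-- `x` lies on a shortest (= unique, in a tree) path from `a` to `b`. -/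
def onPath (G : SimpleGraph V) (a x b : V) : Prop :=
  G.dist a x + G.dist x b = G.dist a b

/-- `x` is a common ancestor of `u` and `v` (tree rooted at its weight centers). -/
def IsCommonAncestor (G : SimpleGraph V) (x u v : V) : Prop :=
  (∃ w ∈ weightCenters G, onPath G w x u) ∧ ∃ w ∈ weightCenters G, onPath G w x v

/-- `φ(u,v)`: the maximum level of a common ancestor of `u` and `v`. -/
noncomputable def phi (G : SimpleGraph V) (u v : V) : ℕ :=
  sSup (level G '' {x | IsCommonAncestor G x u v})

open scoped Classical in
/-- `δ(u,v) = 1` iff `G` has two weight centers and the `(u,v)`-path contains both. -/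
noncomputable def delta (G : SimpleGraph V) (u v : V) : ℕ :=
  if (weightCenters G).ncard = 2 ∧ ∀ x ∈ weightCenters G, onPath G u x v then 1 else 0

/-- `u` and `v` are in different branches: their path contains exactly one weight center. -/
def InDifferentBranches (G : SimpleGraph V) (u v : V) : Prop :=
  {x ∈ weightCenters G | onPath G u x v}.ncard = 1

/-- `u` and `v` are in opposite branches: the tree has two weight centers and the
`(u,v)`-path contains both. -/
def InOppositeBranches (G : SimpleGraph V) (u v : V) : Prop :=
  (weightCenters G).ncard = 2 ∧ ∀ x ∈ weightCenters G, onPath G u x v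

/-- `u` and `v` are in the same branch: their path contains no weight center. -/
def InSameBranch (G : SimpleGraph V) (u v : V) : Prop :=
  ∀ x ∈ weightCenters G, ¬ onPath G u x v


/-- The double star `D_q`: two copies of the star `K_{1,q}` with their centers joined
by an edge.  Vertex `(s, 0)` is the center of copy `s`; vertices `(s, j)` with
`j ≠ 0` are its `q` leaves. -/
def doubleStar (q : ℕ) : SimpleGraph (Fin 2 × Fin (q + 1)) :=
  SimpleGraph.fromRel fun a b =>
    (a.2 = 0 ∧ b.2 = 0 ∧ a.1 ≠ b.1) ∨ (a.1 = b.1 ∧ a.2 = 0 ∧ b.2 ≠ 0)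

/-- Level of a vertex of the double star: `0` for centers, `1` for leaves. -/
def lv {q : ℕ} (a : Fin 2 × Fin (q + 1)) : ℕ := if a.2.val = 0 then 0 else 1

/-- Explicit distance in the double star. -/
def dT {q : ℕ} (a b : Fin 2 × Fin (q + 1)) : ℕ :=
  if a.1.val = b.1.val then (if a.2.val = b.2.val then 0 else lv a + lv b) else lv a + lv b + 1

lemma doubleStar_adj_iff {q : ℕ} (a b : Fin 2 × Fin (q + 1)) :
    (doubleStar q).Adj a b ↔
      (a.1.val ≠ b.1.val ∧ a.2.val = 0 ∧ b.2.val = 0) ∨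
      (a.1.val = b.1.val ∧ ((a.2.val = 0 ∧ b.2.val ≠ 0) ∨ (a.2.val ≠ 0 ∧ b.2.val = 0))) := by
  obtain ⟨s, j⟩ := a
  obtain ⟨s', j'⟩ := b
  simp only [doubleStar, SimpleGraph.fromRel_adj, Prod.mk.injEq, ne_eq, Fin.ext_iff, Fin.val_zero]
  omega

lemma dT_le_length {q : ℕ} {a b : Fin 2 × Fin (q + 1)} (p : (doubleStar q).Walk a b) :
    dT a b ≤ p.length := by
  induction p with
  | nil => simp [dT]
  | @cons u v w h p ih =>
    rw [doubleStar_adj_iff] at h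
    rw [SimpleGraph.Walk.length_cons]
    have h1 := u.1.isLt
    have h2 := v.1.isLt
    have h3 := w.1.isLt
    refine le_trans ?_ (Nat.succ_le_succ ih)
    simp only [dT, lv]
    split_ifs <;> omega

lemma exists_walk_center {q : ℕ} (a : Fin 2 × Fin (q + 1)) :
    ∃ p : (doubleStar q).Walk a (a.1, 0), p.length = lv a := by
  by_cases h : a.2.val = 0
  · have : a = (a.1, 0) := by
      ext <;> simp [h]
    rw [this]
    exact ⟨SimpleGraph.Walk.nil, by simp [lv]⟩
  · have hadj : (doubleStar q).Adj a (a.1, 0) := by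
      rw [doubleStar_adj_iff]; simp [h]
    exact ⟨hadj.toWalk, by simp [lv, h]⟩

lemma exists_walk_dT {q : ℕ} (a b : Fin 2 × Fin (q + 1)) :
    ∃ p : (doubleStar q).Walk a b, p.length = dT a b := by
  obtain ⟨p, hp⟩ := exists_walk_center a
  obtain ⟨r, hr⟩ := exists_walk_center b
  by_cases hab : a = b
  · subst hab
    exact ⟨SimpleGraph.Walk.nil, by simp [dT]⟩
  by_cases h : a.1 = b.1
  · have hne : a.2.val ≠ b.2.val := fun h2 => hab (Prod.ext h (Fin.ext h2))
    obtain ⟨p, hp⟩ : ∃ p : (doubleStar q).Walk a (b.1, 0), p.length = lv a := by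
      rw [← h]
      exact exists_walk_center a
    refine ⟨p.append r.reverse, ?_⟩
    simp only [SimpleGraph.Walk.length_append, SimpleGraph.Walk.length_reverse, hr, hp]
    simp only [dT, h, if_true, hne, if_false]
  · have hadj : (doubleStar q).Adj (a.1, 0) (b.1, 0) := by
      rw [doubleStar_adj_iff]
      simp only [Fin.val_zero]
      exact Or.inl ⟨fun h' => h (Fin.ext h'), trivial, trivial⟩
    refine ⟨p.append (SimpleGraph.Walk.cons hadj r.reverse), ?_⟩
    have h' : a.1.val ≠ b.1.val := fun h' => h (Fin.ext h')
    simp only [SimpleGraph.Walk.length_append, SimpleGraph.Walk.length_cons,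
      SimpleGraph.Walk.length_reverse, hr, hp]
    simp only [dT, h', if_false]
    omega

lemma edist_doubleStar {q : ℕ} (a b : Fin 2 × Fin (q + 1)) :
    (doubleStar q).edist a b = (dT a b : ℕ∞) := by
  obtain ⟨p, hp⟩ := exists_walk_dT a b
  apply le_antisymm
  · rw [← hp]; exact SimpleGraph.edist_le p
  · obtain ⟨r, hr⟩ := p.reachable.exists_walk_length_eq_edist
    rw [← hr]
    exact_mod_cast dT_le_length r

lemma edist_prod {q n : ℕ} (x y : (Fin 2 × Fin (q + 1)) × Fin n) :
    ((doubleStar q) □ (⊤ : SimpleGraph (Fin n))).edist x y =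
      ((dT x.1 y.1 + if x.2.val = y.2.val then 0 else 1 : ℕ) : ℕ∞) := by
  rw [SimpleGraph.edist_boxProd, edist_doubleStar]
  by_cases h : x.2 = y.2
  · simp [h]
  · have h' : x.2.val ≠ y.2.val := fun h' => h (Fin.ext h')
    rw [SimpleGraph.edist_top_of_ne h]
    simp [h']

lemma dist_prod {q n : ℕ} (x y : (Fin 2 × Fin (q + 1)) × Fin n) :
    ((doubleStar q) □ (⊤ : SimpleGraph (Fin n))).dist x y =
      dT x.1 y.1 + if x.2.val = y.2.val then 0 else 1 := by
  rw [SimpleGraph.dist, edist_prod, ENat.toNat_natCast]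

lemma dT_le {q : ℕ} (a b : Fin 2 × Fin (q + 1)) : dT a b ≤ lv a + lv b + 1 := by
  simp only [dT]; split_ifs <;> omega

lemma lv_le {q : ℕ} (a : Fin 2 × Fin (q + 1)) : lv a ≤ 1 := by
  simp only [lv]; split_ifs <;> omega

lemma diam_prod {q n : ℕ} (hq : 2 ≤ q) (hn : 4 ≤ n) :
    ((doubleStar q) □ (⊤ : SimpleGraph (Fin n))).diam = 4 := by
  have hle : ((doubleStar q) □ (⊤ : SimpleGraph (Fin n))).ediam ≤ ((4 : ℕ) : ℕ∞) := by
    refine SimpleGraph.ediam_le_of_edist_le fun x y => ?_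
    rw [edist_prod]
    have h1 := dT_le x.1 y.1
    have h2 := lv_le x.1
    have h3 := lv_le y.1
    rw [Nat.cast_le]
    split_ifs <;> omega
  have hge : ((4 : ℕ) : ℕ∞) ≤ ((doubleStar q) □ (⊤ : SimpleGraph (Fin n))).ediam := by
    let x : (Fin 2 × Fin (q + 1)) × Fin n := ((0, ⟨1, by omega⟩), ⟨0, by omega⟩)
    let y : (Fin 2 × Fin (q + 1)) × Fin n := ((1, ⟨1, by omega⟩), ⟨1, by omega⟩)
    refine le_trans ?_ (SimpleGraph.edist_le_ediam (u := x) (v := y))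
    rw [edist_prod]
    simp [x, y, dT, lv]
  rw [SimpleGraph.diam, le_antisymm hle hge, ENat.toNat_natCast]

/-- Lower bound by removing the vertex of largest label. -/
lemma lower_aux {α : Type*} [DecidableEq α] (f L : α → ℕ) (hL : ∀ a, L a ≤ 1)
    (h : ∀ u v, u ≠ v → 3 ≤ Nat.dist (f u) (f v) + L u + L v) (s : Finset α) :
    s.Nonempty → ∃ x ∈ s, ∃ y ∈ s,
      f x + (∑ z ∈ s, (3 - 2 * L z)) + L x + L y ≤ f y + 3 := by
  induction s using Finset.induction_on_max_value f with
  | empty => intro h; simp at h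
  | insert a s ha hmax ih =>
    intro _
    rcases s.eq_empty_or_nonempty with rfl | hs
    · refine ⟨a, by simp, a, by simp, ?_⟩
      have := hL a
      simp
      omega
    · obtain ⟨x, hx, y, hy, hxy⟩ := ih hs
      refine ⟨x, by simp [hx], a, by simp, ?_⟩
      rw [Finset.sum_insert ha]
      have h1 := h a y (fun e => ha (e ▸ hy))
      have h2 := hmax y hy
      have h3 := hL a
      have h4 := hL y
      rw [Nat.dist_eq_sub_of_le_right h2] at h1
      omega

lemma sum_weight (q n : ℕ) :
    ∑ z : (Fin 2 × Fin (q + 1)) × Fin n, (3 - 2 * lv z.1) = 2 * n * (q + 3) := by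
  rw [Fintype.sum_prod_type, Fintype.sum_prod_type]
  simp only [lv, Fin.sum_univ_succ]
  simp
  ring

lemma lower_bound {q n : ℕ} (hq : 2 ≤ q) (hn : 4 ≤ n)
    (f : (Fin 2 × Fin (q + 1)) × Fin n → ℕ)
    (hf : IsRadioLabelling ((doubleStar q) □ (⊤ : SimpleGraph (Fin n))) f) :
    2 * n * (q + 3) - 3 ≤ spanOf f := by
  have hne : (Finset.univ : Finset ((Fin 2 × Fin (q + 1)) × Fin n)).Nonempty :=
    ⟨((0, 0), ⟨0, by omega⟩), Finset.mem_univ _⟩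
  obtain ⟨x, -, y, -, hxy⟩ := lower_aux f (fun z => lv z.1) (fun z => lv_le z.1)
    (by
      intro u v huv
      have h1 := hf u v huv
      rw [diam_prod hq hn, dist_prod] at h1
      have h2 := dT_le u.1 v.1
      split_ifs at h1 <;> omega) Finset.univ hne
  rw [sum_weight] at hxy
  have h1 : Nat.dist (f x) (f y) ≤ spanOf f :=
    Finset.le_sup (f := fun p : _ × _ => Nat.dist (f p.1) (f p.2)) (Finset.mem_univ (x, y))
  have h2 : f y - f x ≤ Nat.dist (f x) (f y) := by
    unfold Nat.dist; omega
  omega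

/-- Offset of a label within its block. -/
def off (q s j : ℕ) : ℕ :=
  if s = 0 then (if j = 0 then 0 else 2 * j + 1) else (if j = 0 then 2 * q + 3 else 2 * j)

/-- Shift of the `K_n`-coordinate within a block. -/
def shift (q s j : ℕ) : ℕ :=
  if s = 0 then j % 2 else (if j = 0 then 2 + q % 2 else 2 + (j - 1) % 2)

/-- Block index. -/
def blk (q n s j k : ℕ) : ℕ := (k + n - shift q s j) % n

/-- The optimal labelling. -/
def lab (q n : ℕ) (x : (Fin 2 × Fin (q + 1)) × Fin n) : ℕ :=
  blk q n x.1.1.val x.1.2.val x.2.val * (2 * q + 6) + off q x.1.1.val x.1.2.val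

lemma shift_le (q s j : ℕ) : shift q s j ≤ 3 := by
  simp only [shift]; split_ifs <;> omega

lemma off_le (q s j : ℕ) (hj : j ≤ q) : off q s j ≤ 2 * q + 3 := by
  simp only [off]; split_ifs <;> omega

lemma blk_spec (q n s j k : ℕ) (hn : 4 ≤ n) (hk : k < n) :
    blk q n s j k < n ∧ (k = blk q n s j k + shift q s j ∨
      k + n = blk q n s j k + shift q s j) := by
  have h := shift_le q s j
  refine ⟨Nat.mod_lt _ (by omega), ?_⟩
  unfold blk
  rcases Nat.lt_or_ge k (shift q s j) with h1 | h1
  · rw [Nat.mod_eq_of_lt (by omega)]; omega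
  · rw [show k + n - shift q s j = (k - shift q s j) + n by omega, Nat.add_mod_right,
      Nat.mod_eq_of_lt (by omega)]
    omega

lemma radio_aux {q n : ℕ} (hq : 2 ≤ q) (hn : 4 ≤ n)
    (u v : (Fin 2 × Fin (q + 1)) × Fin n) (huv : u ≠ v) (hle : lab q n u ≤ lab q n v) :
    5 ≤ (lab q n v - lab q n u) + (dT u.1 v.1 + if u.2.val = v.2.val then 0 else 1) := by
  obtain ⟨⟨s, j⟩, k⟩ := u
  obtain ⟨⟨s', j'⟩, k'⟩ := v
  have hne : ¬ (s.val = s'.val ∧ j.val = j'.val ∧ k.val = k'.val) := by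
    rintro ⟨h1, h2, h3⟩
    exact huv (by rw [Fin.ext h1, Fin.ext h2, Fin.ext h3])
  simp only [lab, dT, lv] at hle ⊢
  obtain ⟨s, hs⟩ := s
  obtain ⟨j, hj⟩ := j
  obtain ⟨k, hk⟩ := k
  obtain ⟨s', hs'⟩ := s'
  obtain ⟨j', hj'⟩ := j'
  obtain ⟨k', hk'⟩ := k'
  clear huv
  simp only at hle hne ⊢
  obtain ⟨b1, b2⟩ := blk_spec q n s j k hn hk
  obtain ⟨c1, c2⟩ := blk_spec q n s' j' k' hn hk'
  have o1 := off_le q s j (by omega)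
  have o2 := off_le q s' j' (by omega)
  generalize blk q n s j k = t at *
  generalize blk q n s' j' k' = t' at *
  rcases Nat.lt_trichotomy t t' with h | h | h
  · obtain ⟨r, rfl⟩ : ∃ r, t' = t + 1 + r := ⟨t' - t - 1, by omega⟩
    have e : (t + 1 + r) * (2 * q + 6) = t * (2 * q + 6) + (2 * q + 6) + r * (2 * q + 6) := by ring
    rw [e] at hle ⊢
    generalize t * (2 * q + 6) = A at *
    rcases Nat.eq_zero_or_pos r with rfl | hr
    · simp only [off, shift] at *
      split_ifs at * <;> omega
    · have : 2 * q + 6 ≤ r * (2 * q + 6) := Nat.le_mul_of_pos_left _ hr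
      omega
  · subst h
    generalize t * (2 * q + 6) = A at *
    simp only [off, shift] at *
    split_ifs at * <;> omega
  · exfalso
    have : (t' + 1) * (2 * q + 6) ≤ t * (2 * q + 6) := Nat.mul_le_mul_right _ h
    rw [Nat.add_mul] at this
    omega

lemma lab_radio {q n : ℕ} (hq : 2 ≤ q) (hn : 4 ≤ n) :
    IsRadioLabelling ((doubleStar q) □ (⊤ : SimpleGraph (Fin n))) (lab q n) := by
  intro u v huv
  rw [diam_prod hq hn]
  rcases Nat.le_total (lab q n u) (lab q n v) with h | h
  · rw [Nat.dist_eq_sub_of_le h, dist_prod]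
    exact radio_aux hq hn u v huv h
  · rw [Nat.dist_eq_sub_of_le_right h, SimpleGraph.dist_comm, dist_prod]
    exact radio_aux hq hn v u huv.symm h

lemma lab_le {q n : ℕ} (hn : 4 ≤ n) (u : (Fin 2 × Fin (q + 1)) × Fin n) :
    lab q n u ≤ 2 * n * (q + 3) - 3 := by
  have h1 := (blk_spec q n u.1.1.val u.1.2.val u.2.val hn u.2.isLt).1
  have h2 := off_le q u.1.1.val u.1.2.val (by have := u.1.2.isLt; omega)
  have h3 := Nat.mul_le_mul_right (2 * q + 6) (Nat.succ_le_of_lt h1)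
  rw [Nat.succ_mul] at h3
  have h4 : 2 * n * (q + 3) = n * (2 * q + 6) := by ring
  unfold lab
  omega

lemma spanOf_lab_le {q n : ℕ} (hn : 4 ≤ n) : spanOf (lab q n) ≤ 2 * n * (q + 3) - 3 := by
  refine Finset.sup_le fun p _ => ?_
  have h1 := lab_le hn p.1
  have h2 := lab_le hn p.2
  unfold Nat.dist
  omega

/-- `rn(D_q □ K_n) = 2n(q + 3) − 3` for `q ≥ 2`, `n ≥ 4`. -/
theorem radioNumber_doubleStar_boxProd_complete (q n : ℕ) (hq : 2 ≤ q) (hn : 4 ≤ n) :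
    radioNumber ((doubleStar q) □ (⊤ : SimpleGraph (Fin n))) =
      2 * n * (q + 3) - 3 := by
  have hmem : spanOf (lab q n) ∈ { k | ∃ f : (Fin 2 × Fin (q + 1)) × Fin n → ℕ,
      IsRadioLabelling ((doubleStar q) □ (⊤ : SimpleGraph (Fin n))) f ∧ spanOf f = k } :=
    ⟨lab q n, lab_radio hq hn, rfl⟩
  apply le_antisymm
  · exact le_trans (Nat.sInf_le hmem) (spanOf_lab_le hn)
  · refine le_csInf ⟨_, hmem⟩ ?_
    rintro k ⟨f, hf, rfl⟩
    exact lower_bound hq hn f hf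

end RadioPaper
end

section
/- Let m ≥ 4 be an odd integer and n ≥ 3 an integer, and let P_m be the path on m vertices. Then rn(P_m □ K_n) = (m²n − 2m + n + 2)/2. -/
open SimpleGraph Finset

namespace RadioPaper

variable {V : Type*} [Fintype V]

lemma dist_path_le {m : ℕ} (d : ℕ) : ∀ (u v : Fin m), u.val + d = v.val →
    ∃ w : (SimpleGraph.pathGraph m).Walk u v, w.length = d := by
  induction d with
  | zero =>
    intro u v h
    obtain rfl : u = v := Fin.ext (by simpa using h)
    exact ⟨SimpleGraph.Walk.nil, rfl⟩
  | succ d ih =>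
    intro u v h
    have hlt : u.val + 1 < m := by have := v.isLt; omega
    obtain ⟨w, hw⟩ := ih ⟨u.val + 1, hlt⟩ v (by simp; omega)
    refine ⟨SimpleGraph.Walk.cons (SimpleGraph.pathGraph_adj.2 (Or.inl rfl)) w, by simp [hw]⟩

lemma path_walk_ge {m : ℕ} {u v : Fin m} (w : (SimpleGraph.pathGraph m).Walk u v) :
    Nat.dist u.val v.val ≤ w.length := by
  induction w with
  | nil => simp
  | cons h p ih =>
    rw [SimpleGraph.pathGraph_adj] at h
    simp only [SimpleGraph.Walk.length_cons]
    unfold Nat.dist at *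
    omega

lemma path_edist {m : ℕ} (u v : Fin m) :
    (SimpleGraph.pathGraph m).edist u v = (Nat.dist u.val v.val : ℕ) := by
  apply le_antisymm
  · rcases le_total u.val v.val with h | h
    · obtain ⟨w, hw⟩ := dist_path_le (v.val - u.val) u v (by omega)
      refine (SimpleGraph.edist_le w).trans ?_
      rw [hw, Nat.dist_eq_sub_of_le h]
    · obtain ⟨w, hw⟩ := dist_path_le (u.val - v.val) v u (by omega)
      rw [SimpleGraph.edist_comm]
      refine (SimpleGraph.edist_le w).trans ?_
      rw [hw, Nat.dist_comm, Nat.dist_eq_sub_of_le h]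
  · obtain ⟨w, hw⟩ := SimpleGraph.Reachable.exists_walk_length_eq_edist
      (SimpleGraph.pathGraph_preconnected m u v)
    rw [← hw]
    exact_mod_cast path_walk_ge w

lemma box_edist {m n : ℕ} (u v : Fin m × Fin n) :
    ((SimpleGraph.pathGraph m) □ (⊤ : SimpleGraph (Fin n))).edist u v =
      ((Nat.dist u.1.val v.1.val + (if u.2.val = v.2.val then 0 else 1) : ℕ) : ℕ∞) := by
  rw [SimpleGraph.edist_boxProd, path_edist, SimpleGraph.edist_top]
  by_cases h : u.2 = v.2
  · simp [h]
  · have h' : u.2.val ≠ v.2.val := fun e => h (Fin.ext e)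
    simp [h, h']

lemma box_dist {m n : ℕ} (u v : Fin m × Fin n) :
    ((SimpleGraph.pathGraph m) □ (⊤ : SimpleGraph (Fin n))).dist u v =
      Nat.dist u.1.val v.1.val + (if u.2.val = v.2.val then 0 else 1) := by
  rw [SimpleGraph.dist, box_edist, ENat.toNat_natCast]

lemma box_diam {m n : ℕ} (hm : 4 ≤ m) (hn : 3 ≤ n) :
    ((SimpleGraph.pathGraph m) □ (⊤ : SimpleGraph (Fin n))).diam = m := by
  have : Nonempty (Fin m) := ⟨⟨0, by omega⟩⟩
  have : Nonempty (Fin n) := ⟨⟨0, by omega⟩⟩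
  set G := ((SimpleGraph.pathGraph m) □ (⊤ : SimpleGraph (Fin n))) with hG
  have htop : G.ediam ≠ ⊤ := by
    obtain ⟨u, v, huv⟩ := G.exists_edist_eq_ediam_of_finite
    rw [← huv, hG, box_edist]
    exact ENat.natCast_ne_top _
  apply le_antisymm
  · obtain ⟨u, v, huv⟩ := G.exists_dist_eq_diam
    rw [← huv, hG, box_dist]
    have h1 := u.1.isLt
    have h2 := v.1.isLt
    unfold Nat.dist
    split_ifs <;> omega
  · have h := SimpleGraph.dist_le_diam htop
      (u := ((⟨0, by omega⟩ : Fin m), (⟨0, by omega⟩ : Fin n)))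
      (v := ((⟨m - 1, by omega⟩ : Fin m), (⟨1, by omega⟩ : Fin n)))
    rw [hG, box_dist] at h
    rw [← hG] at h
    simp [Nat.dist] at h
    omega

lemma radio_iff {m n : ℕ} (hm : 4 ≤ m) (hn : 3 ≤ n) (f : Fin m × Fin n → ℕ) :
    IsRadioLabelling ((SimpleGraph.pathGraph m) □ (⊤ : SimpleGraph (Fin n))) f ↔
      ∀ u v, u ≠ v → m + 1 ≤ Nat.dist (f u) (f v) +
        (Nat.dist u.1.val v.1.val + (if u.2.val = v.2.val then 0 else 1)) := by
  unfold IsRadioLabelling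
  rw [box_diam hm hn]
  simp only [box_dist]

/-! ### Upper bound -/

/-- Linear description of the labelling, with block index `j`, position `q`, offset `c`. -/
def Spec (k n X x a j q c : ℤ) : Prop :=
  (x < k ∧ q = k - x ∧ (a < 2 ∧ j = a + n - 2 ∨ 2 ≤ a ∧ j = a - 2) ∧
    (j = n - 1 ∧ c = -2 * k ∨ j < n - 1 ∧ c = 0)) ∨
  (x = k ∧ q = 0 ∧ j = a ∧ (j = n - 1 ∧ c = X - k + 1 ∨ j < n - 1 ∧ c = 0)) ∨
  (k < x ∧ q = 2 * k - x ∧ (a = 0 ∧ j = n - 1 ∨ 1 ≤ a ∧ j = a - 1) ∧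
    (j = n - 1 ∧ c = -k + 1 ∨ j < n - 1 ∧ c = k + 1))

lemma five (E m : ℤ) (hm : 0 ≤ m) : (E ≤ -2 ∧ E * m ≤ -2 * m) ∨ (E = -1 ∧ E * m = -m) ∨
    (E = 0 ∧ E * m = 0) ∨ (E = 1 ∧ E * m = m) ∨ (2 ≤ E ∧ 2 * m ≤ E * m) := by
  rcases lt_trichotomy E 0 with h | h | h
  · rcases eq_or_ne E (-1) with h1 | h1
    · right; left; subst h1; constructor <;> ring
    · left; constructor
      · omega
      · have : E ≤ -2 := by omega
        nlinarith
  · subst h; simp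
  · rcases eq_or_ne E 1 with h1 | h1
    · subst h1; simp
    · right; right; right; right
      have : 2 ≤ E := by omega
      constructor
      · exact this
      · nlinarith

set_option maxHeartbeats 4000000 in
lemma core (k n X B x a j q c x' a' j' q' c' ax cc F F' : ℤ) (hk : 2 ≤ k) (hn : 3 ≤ n)
    (hX : X = k * (2 * k + 1)) (hB : B = X + k + 1)
    (hx : 0 ≤ x) (hx2 : x ≤ 2 * k) (ha : 0 ≤ a) (han : a < n)
    (hx' : 0 ≤ x') (hx2' : x' ≤ 2 * k) (ha' : 0 ≤ a') (han' : a' < n)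
    (h : Spec k n X x a j q c) (h' : Spec k n X x' a' j' q' c')
    (hF : F = j * B + q * (2 * k + 1) + c) (hF' : F' = j' * B + q' * (2 * k + 1) + c')
    (hne : x ≠ x' ∨ a ≠ a')
    (h1 : x - x' ≤ ax) (h2 : x' - x ≤ ax) (h3 : 0 ≤ cc) (h4 : a ≠ a' → 1 ≤ cc)
    (hj : j ≤ j') :
    2 * k + 2 ≤ F' - F + (ax + cc) ∨ 2 * k + 2 ≤ F - F' + (ax + cc) := by
  have hX2 : 2 * (2 * k + 1) ≤ X := by nlinarith
  have hd := five (j' - j) B (by omega)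
  have hE := five (q' - q) (2 * k + 1) (by omega)
  have hE1 := five (k + (q' - q)) (2 * k + 1) (by omega)
  have e1 : (k + (q' - q)) * (2 * k + 1) = X + (q' - q) * (2 * k + 1) := by rw [hX]; ring
  have hFF : F' - F = (j' - j) * B + (q' - q) * (2 * k + 1) + (c' - c) := by
    rw [hF, hF']; ring
  have hE2 := five (k - (q' - q)) (2 * k + 1) (by omega)
  have e2 : (k - (q' - q)) * (2 * k + 1) = X - (q' - q) * (2 * k + 1) := by rw [hX]; ring
  rw [e1] at hE1
  rw [e2] at hE2
  generalize (j' - j) * B = D at *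
  generalize (q' - q) * (2 * k + 1) = W at *
  have hGG : F - F' = -(F' - F) := by ring
  rw [hGG, hFF]
  clear hGG hFF hF hF' e1 e2 hX F F'
  subst hB
  rcases h with ⟨s1, s2, s3, s4⟩ | ⟨s1, s2, s3, s4⟩ | ⟨s1, s2, s3, s4⟩ <;>
  rcases h' with ⟨t1, t2, t3, t4⟩ | ⟨t1, t2, t3, t4⟩ | ⟨t1, t2, t3, t4⟩ <;>
  rcases s4 with ⟨s4, s5⟩ | ⟨s4, s5⟩ <;> rcases t4 with ⟨t4, t5⟩ | ⟨t4, t5⟩ <;>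
  rcases hd with hd | hd | hd | hd | hd <;> omega

lemma exists_spec (k n X B x a : ℤ) (hk : 2 ≤ k) (hn : 3 ≤ n)
    (hX : X = k * (2 * k + 1)) (hB : B = X + k + 1)
    (hx : 0 ≤ x) (hx2 : x ≤ 2 * k) (ha : 0 ≤ a) (han : a < n) :
    ∃ F : ℕ, ∃ j q c : ℤ, Spec k n X x a j q c ∧ (F : ℤ) = j * B + q * (2 * k + 1) + c ∧
      (F : ℤ) ≤ (n - 1) * B + X - k + 1 := by
  have key : ∃ j q c : ℤ, Spec k n X x a j q c := by
    unfold Spec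
    rcases lt_trichotomy x k with h | h | h
    · by_cases h2 : a < 2
      · by_cases h3 : a + n - 2 = n - 1
        · exact ⟨a + n - 2, k - x, -2 * k, by omega⟩
        · exact ⟨a + n - 2, k - x, 0, by omega⟩
      · exact ⟨a - 2, k - x, 0, by omega⟩
    · by_cases h3 : a = n - 1
      · exact ⟨a, 0, X - k + 1, by omega⟩
      · exact ⟨a, 0, 0, by omega⟩
    · by_cases h2 : a = 0
      · exact ⟨n - 1, 2 * k - x, -k + 1, by omega⟩
      · exact ⟨a - 1, 2 * k - x, k + 1, by omega⟩
  obtain ⟨j, q, c, hs⟩ := key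
  have hX2 : 2 * (2 * k + 1) ≤ X := by nlinarith
  have h1 := five j B (by omega)
  have h2 := five (n - 1 - j) B (by omega)
  have e2 : (n - 1 - j) * B = (n - 1) * B - j * B := by ring
  have h3 := five q (2 * k + 1) (by omega)
  have h4 := five (k - q) (2 * k + 1) (by omega)
  have e4 : (k - q) * (2 * k + 1) = X - q * (2 * k + 1) := by rw [hX]; ring
  rw [e2] at h2
  rw [e4] at h4
  have h5 : 0 ≤ j * B + q * (2 * k + 1) + c ∧
      j * B + q * (2 * k + 1) + c ≤ (n - 1) * B + X - k + 1 := by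
    generalize j * B = u1 at *
    generalize (n - 1) * B = u2 at *
    generalize q * (2 * k + 1) = u3 at *
    unfold Spec at hs
    clear e2 e4 hX
    constructor <;>
    rcases hs with ⟨s1, s2, s3, s4⟩ | ⟨s1, s2, s3, s4⟩ | ⟨s1, s2, s3, s4⟩ <;>
    rcases s4 with ⟨s4, s5⟩ | ⟨s4, s5⟩ <;> omega
  refine ⟨(j * B + q * (2 * k + 1) + c).toNat, j, q, c, hs, ?_, ?_⟩
  · rw [Int.toNat_of_nonneg h5.1]
  · rw [Int.toNat_of_nonneg h5.1]; exact h5.2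

lemma upper (k n : ℕ) (hk : 2 ≤ k) (hn : 3 ≤ n) :
    ∃ f : Fin (2 * k + 1) × Fin n → ℕ,
      IsRadioLabelling ((SimpleGraph.pathGraph (2 * k + 1)) □ (⊤ : SimpleGraph (Fin n))) f ∧
      spanOf f + 2 * k ≤ n * (2 * k ^ 2 + 2 * k + 1) := by
  have hex : ∀ v : Fin (2 * k + 1) × Fin n, _ := fun v =>
    exists_spec k n _ _ (v.1.val : ℤ) (v.2.val : ℤ) (by omega) (by omega) rfl rfl
      (by omega) (by have := v.1.isLt; omega) (by omega) (by have := v.2.isLt; omega)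
  choose f j q c hs hf hb using hex
  refine ⟨f, ?_, ?_⟩
  · rw [radio_iff (by omega) hn]
    have main : ∀ u v, u ≠ v → j u ≤ j v → 2 * k + 1 + 1 ≤ Nat.dist (f u) (f v) +
        (Nat.dist u.1.val v.1.val + (if u.2.val = v.2.val then 0 else 1)) := by
      intro u v huv hj
      have hne : (u.1.val : ℤ) ≠ v.1.val ∨ (u.2.val : ℤ) ≠ v.2.val := by
        by_contra hcon
        push Not at hcon
        exact huv (Prod.ext (Fin.ext (by exact_mod_cast hcon.1))
          (Fin.ext (by exact_mod_cast hcon.2)))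
      have := core k n _ _ _ _ _ _ _ _ _ _ _ _ (Nat.dist u.1.val v.1.val : ℕ)
        ((if u.2.val = v.2.val then 0 else 1 : ℕ) : ℤ) _ _ (by omega) (by omega) rfl rfl
        (by omega) (by have := u.1.isLt; omega) (by omega) (by have := u.2.isLt; omega)
        (by omega) (by have := v.1.isLt; omega) (by omega) (by have := v.2.isLt; omega)
        (hs u) (hs v) (hf u) (hf v) hne (by unfold Nat.dist; omega) (by unfold Nat.dist; omega)
        (by omega) (by intro h; split_ifs <;> omega) hj
      generalize (if u.2.val = v.2.val then 0 else 1 : ℕ) = cc at *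
      generalize Nat.dist u.1.val v.1.val = dd at *
      unfold Nat.dist
      omega
    intro u v huv
    rcases le_total (j u) (j v) with h | h
    · exact main u v huv h
    · have := main v u huv.symm h
      rw [Nat.dist_comm (f u), Nat.dist_comm u.1.val]
      simpa only [eq_comm] using this
  · have hfb : ∀ v, f v + 2 * k ≤ n * (2 * k ^ 2 + 2 * k + 1) := by
      intro v
      have := hb v
      zify
      refine le_trans (add_le_add_left this _) (le_of_eq ?_)
      ring
    have hle : spanOf f ≤ n * (2 * k ^ 2 + 2 * k + 1) - 2 * k := by
      unfold spanOf
      apply Finset.sup_le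
      intro p _
      have h1 := hfb p.1
      have h2 := hfb p.2
      unfold Nat.dist
      omega
    have := hfb (⟨0, by omega⟩, ⟨0, by omega⟩)
    omega

/-! ### Lower bound -/

lemma sum_left (k j : ℕ) (hj : j ≤ k) :
    2 * ∑ x ∈ Finset.range j, |((x : ℕ) : ℤ) - k| = j * (2 * k - j + 1) := by
  induction j with
  | zero => simp
  | succ j ih =>
    rw [Finset.sum_range_succ, mul_add, ih (by omega), abs_of_nonpos (by omega)]
    push_cast; ring

lemma sum_right (k j : ℕ) :
    2 * ∑ x ∈ Finset.range j, |((k + x : ℕ) : ℤ) - k| = j * (j - 1) := by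
  induction j with
  | zero => simp
  | succ j ih =>
    rw [Finset.sum_range_succ, mul_add, ih, abs_of_nonneg (by omega)]
    push_cast; ring

lemma sum_levels (k n : ℕ) :
    ∑ v : Fin (2 * k + 1) × Fin n, |(v.1.val : ℤ) - k| = n * (k * (k + 1)) := by
  rw [Fintype.sum_prod_type]
  simp only [Finset.sum_const, Finset.card_univ, Fintype.card_fin, nsmul_eq_mul]
  rw [← Finset.mul_sum, Fin.sum_univ_eq_sum_range (fun x => |(x : ℤ) - k|) (2 * k + 1),
    show 2 * k + 1 = k + (k + 1) by ring, Finset.sum_range_add]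
  have h1 := sum_left k k le_rfl
  have h2 := sum_right k (k + 1)
  push_cast at h1 h2 ⊢
  congr 1
  linarith [h1, h2, (by ring : (k : ℤ) * (2 * k - k + 1) + (k + 1) * (k + 1 - 1)
    = 2 * (k * (k + 1)))]

lemma lower (k n : ℕ) (hk : 2 ≤ k) (hn : 3 ≤ n) (f : Fin (2 * k + 1) × Fin n → ℕ)
    (hf : IsRadioLabelling ((SimpleGraph.pathGraph (2 * k + 1)) □ (⊤ : SimpleGraph (Fin n))) f) :
    n * (2 * k ^ 2 + 2 * k + 1) ≤ spanOf f + 2 * k := by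
  rw [radio_iff (by omega) hn] at hf
  by_contra hlt
  push Not at hlt
  obtain ⟨M, hM⟩ : ∃ M, (2 * k + 1) * n = M + 1 :=
    ⟨(2 * k + 1) * n - 1, by have : 0 < (2 * k + 1) * n := by positivity
                             omega⟩
  -- sort the vertices by label
  obtain ⟨e, he⟩ : ∃ e : Fin (M + 1) ≃ Fin (2 * k + 1) × Fin n, Monotone (f ∘ e) := by
    have hc : Fintype.card (Fin (2 * k + 1) × Fin n) = M + 1 := by simp [hM]
    let e0 := (Fintype.equivFinOfCardEq hc).symm
    refine ⟨(Tuple.sort (f ∘ e0)).trans e0, ?_⟩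
    exact Tuple.monotone_sort (f ∘ e0)
  have hspan : ∀ u v, Nat.dist (f u) (f v) ≤ spanOf f := fun u v => by
    unfold spanOf
    exact Finset.le_sup (f := fun p : (Fin (2 * k + 1) × Fin n) × (Fin (2 * k + 1) × Fin n) =>
      Nat.dist (f p.1) (f p.2)) (Finset.mem_univ (u, v))
  let F : Fin (M + 1) → ℤ := fun t => (f (e t) : ℤ)
  let p : Fin (M + 1) → ℤ := fun t => ((e t).1.val : ℤ) - k
  -- pairwise condition for sorted vertices
  have hpair : ∀ s t : Fin (M + 1), s < t → 2 * (k : ℤ) + 1 ≤ F t - F s + |p t - p s| := by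
    intro s t hst
    have h1 := hf (e s) (e t) (fun h => hst.ne (e.injective h))
    have h2 : f (e s) ≤ f (e t) := he hst.le
    have h3 : (if (e s).2.val = (e t).2.val then 0 else 1) ≤ 1 := by split_ifs <;> omega
    have h4 : |p t - p s| = (Nat.dist (e s).1.val (e t).1.val : ℕ) := by
      simp only [p]
      unfold Nat.dist
      rcases le_total (e s).1.val (e t).1.val with h | h
      · rw [abs_of_nonneg (by omega)]; omega
      · rw [abs_of_nonpos (by omega)]; omega
    rw [h4]
    generalize (if (e s).2.val = (e t).2.val then 0 else 1) = cc at *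
    generalize Nat.dist (e s).1.val (e t).1.val = dd at *
    rw [Nat.dist_eq_sub_of_le h2] at h1
    simp only [F]
    omega
  let δ : Fin M → ℤ := fun t =>
    F t.succ - F t.castSucc + |p t.succ| + |p t.castSucc| - (2 * k + 1)
  have hδ0 : ∀ t, 0 ≤ δ t := by
    intro t
    have h1 := hpair t.castSucc t.succ (Fin.castSucc_lt_succ)
    have h2 := abs_sub (p t.succ) (p t.castSucc)
    simp only [δ]
    linarith
  have hsum : ∑ t, |p t| = n * (k * (k + 1)) := by
    rw [← sum_levels k n]
    exact e.sum_comp (fun v => |(v.1.val : ℤ) - k|)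
  have hδsum : ∑ t, δ t = (F (Fin.last M) - F 0) + (2 * (n * (k * (k + 1)))
      - |p 0| - |p (Fin.last M)|) - M * (2 * k + 1) := by
    simp only [δ, Finset.sum_sub_distrib, Finset.sum_add_distrib, Finset.sum_const,
      Finset.card_univ, Fintype.card_fin, nsmul_eq_mul]
    have a1 := Fin.sum_univ_succ F
    have a2 := Fin.sum_univ_castSucc F
    have a3 := Fin.sum_univ_succ (fun t => |p t|)
    have a4 := Fin.sum_univ_castSucc (fun t => |p t|)
    rw [hsum] at a3 a4
    linarith
  have htot : F (Fin.last M) - F 0 ≤ n * (2 * k ^ 2 + 2 * k + 1) - 2 * k - 1 := by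
    have h1 := hspan (e 0) (e (Fin.last M))
    have h2 : f (e 0) ≤ f (e (Fin.last M)) := he (Fin.zero_le _)
    rw [Nat.dist_eq_sub_of_le h2] at h1
    zify [h2] at h1 hlt
    simp only [F]
    linarith
  have hMz : (M : ℤ) = (2 * k + 1) * n - 1 := by
    have : ((2 * k + 1 : ℤ)) * n = M + 1 := by exact_mod_cast hM
    linarith
  have hle : ∑ t, δ t ≤ - |p 0| - |p (Fin.last M)| := by
    rw [hδsum, hMz]
    nlinarith [htot]
  have hge : 0 ≤ ∑ t, δ t := Finset.sum_nonneg (fun t _ => hδ0 t)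
  have hp0 : p 0 = 0 := by
    have := abs_nonneg (p 0)
    have := abs_nonneg (p (Fin.last M))
    exact abs_eq_zero.1 (by linarith)
  have hpl : p (Fin.last M) = 0 := by
    have := abs_nonneg (p 0)
    have := abs_nonneg (p (Fin.last M))
    exact abs_eq_zero.1 (by linarith)
  have hδ : ∀ t, δ t = 0 := by
    have h0 : ∑ t, δ t = 0 := by
      rw [hp0, hpl] at hle
      simp at hle
      linarith
    intro t
    exact (Finset.sum_eq_zero_iff_of_nonneg (fun t _ => hδ0 t)).1 h0 t (Finset.mem_univ t)
  -- every vertex of level `k` is next to a vertex of level `0`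
  let Z : Finset (Fin (M + 1)) := Finset.univ.filter (fun t => p t = 0)
  let T : Finset (Fin (M + 1)) := Finset.univ.filter (fun t => |p t| = k)
  let A : Finset (Fin M) := Finset.univ.filter (fun t => p t.castSucc = 0)
  let C : Finset (Fin M) := Finset.univ.filter (fun t => p t.succ = 0)
  have hfib : ∀ x : Fin (2 * k + 1),
      (Finset.univ.filter (fun t : Fin (M + 1) => (e t).1 = x)).card = n := by
    intro x
    rw [← Finset.card_map e.toEmbedding]
    have : (Finset.univ.filter (fun t : Fin (M + 1) => (e t).1 = x)).map e.toEmbedding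
        = ({x} : Finset _) ×ˢ (Finset.univ : Finset (Fin n)) := by
      ext v
      simp only [Finset.mem_map_equiv, Finset.mem_filter, Finset.mem_univ, true_and,
        Equiv.apply_symm_apply, Finset.mem_product, Finset.mem_singleton, and_true]
    rw [this]
    simp
  have hZ : Z.card = n := by
    rw [← hfib ⟨k, by omega⟩]
    congr 1
    ext t
    simp only [Z, p, Finset.mem_filter, Finset.mem_univ, true_and, Fin.ext_iff]
    omega
  have hT : 2 * n ≤ T.card := by
    have hd : Disjoint (Finset.univ.filter (fun t : Fin (M + 1) => (e t).1 = ⟨0, by omega⟩))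
        (Finset.univ.filter (fun t : Fin (M + 1) => (e t).1 = ⟨2 * k, by omega⟩)) := by
      rw [Finset.disjoint_left]
      intro t h1 h2
      simp only [Finset.mem_filter, Finset.mem_univ, true_and, Fin.ext_iff] at h1 h2
      omega
    have hcard := Finset.card_union_of_disjoint hd
    rw [hfib, hfib] at hcard
    rw [two_mul, ← hcard]
    apply Finset.card_le_card
    intro t ht
    simp only [Finset.mem_union, Finset.mem_filter, Finset.mem_univ, true_and,
      Fin.ext_iff] at ht
    simp only [T, p, Finset.mem_filter, Finset.mem_univ, true_and]
    rcases ht with ht | ht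
    · rw [ht]; simp
    · rw [ht, abs_of_nonneg] <;> push_cast <;> linarith
  have hA : A.card + 1 ≤ n := by
    have h1 : A.map Fin.castSuccEmb ⊆ Z.erase (Fin.last M) := by
      intro t ht
      obtain ⟨s, hs, rfl⟩ := Finset.mem_map.1 ht
      simp only [A, Finset.mem_filter, Finset.mem_univ, true_and] at hs
      simp only [Z, Finset.mem_erase, Finset.mem_filter, Finset.mem_univ, true_and]
      exact ⟨(Fin.castSucc_lt_last s).ne, hs⟩
    have h2 := Finset.card_le_card h1
    have h3 : Fin.last M ∈ Z := by simp [Z, hpl]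
    rw [Finset.card_map, Finset.card_erase_of_mem h3, hZ] at h2
    omega
  have hC : C.card + 1 ≤ n := by
    have h1 : C.map (Fin.succEmb M) ⊆ Z.erase 0 := by
      intro t ht
      obtain ⟨s, hs, rfl⟩ := Finset.mem_map.1 ht
      simp only [C, Finset.mem_filter, Finset.mem_univ, true_and] at hs
      simp only [Z, Finset.mem_erase, Finset.mem_filter, Finset.mem_univ, true_and]
      exact ⟨Fin.succ_ne_zero s, hs⟩
    have h2 := Finset.card_le_card h1
    have h3 : (0 : Fin (M + 1)) ∈ Z := by simp [Z, hp0]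
    rw [Finset.card_map, Finset.card_erase_of_mem h3, hZ] at h2
    omega
  have hcov : T ⊆ A.map (Fin.succEmb M) ∪ C.map Fin.castSuccEmb := by
    intro t ht
    have htk : |p t| = k := by simpa [T] using ht
    have ht0 : t ≠ 0 := by
      rintro rfl
      rw [hp0] at htk; simp at htk; omega
    have htl : t ≠ Fin.last M := by
      rintro rfl
      rw [hpl] at htk; simp at htk; omega
    obtain ⟨s, rfl⟩ := Fin.exists_succ_eq.2 ht0
    obtain ⟨r, hr⟩ := Fin.exists_castSucc_eq.2 htl
    have key : p s.castSucc = 0 ∨ p r.succ = 0 := by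
      have d1 := hδ s
      have d2 := hδ r
      have q1 := hpair s.castSucc s.succ Fin.castSucc_lt_succ
      have q2 := hpair r.castSucc r.succ Fin.castSucc_lt_succ
      have q3 := hpair s.castSucc r.succ
        (Fin.castSucc_lt_succ.trans (hr ▸ Fin.castSucc_lt_succ))
      simp only [δ] at d1 d2
      rw [hr] at d2 q2
      rw [htk] at d1 d2
      generalize p s.castSucc = a at *
      generalize p r.succ = c at *
      generalize p s.succ = b at *
      have hk' : (2 : ℤ) ≤ k := by exact_mod_cast hk
      rcases abs_cases a with ⟨_, _⟩ | ⟨_, _⟩ <;> rcases abs_cases b with ⟨_, _⟩ | ⟨_, _⟩ <;>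
      rcases abs_cases c with ⟨_, _⟩ | ⟨_, _⟩ <;>
      rcases abs_cases (b - a) with ⟨_, _⟩ | ⟨_, _⟩ <;>
      rcases abs_cases (c - b) with ⟨_, _⟩ | ⟨_, _⟩ <;>
      rcases abs_cases (c - a) with ⟨_, _⟩ | ⟨_, _⟩ <;> omega
    rcases key with h | h
    · refine Finset.mem_union_left _ (Finset.mem_map.2 ⟨s, ?_, rfl⟩)
      simp [A, h]
    · refine Finset.mem_union_right _ (Finset.mem_map.2 ⟨r, ?_, hr⟩)
      simp [C, h]
  have h1 := (Finset.card_le_card hcov).trans (Finset.card_union_le _ _)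
  rw [Finset.card_map, Finset.card_map] at h1
  omega

/-- for odd `m ≥ 4` (i.e. `m ≥ 5` odd) and `n ≥ 3`,
`rn(P_m □ K_n) = (m²n − 2m + n + 2)/2` (stated with both sides doubled). -/
theorem radioNumber_path_boxProd_complete_odd (m n : ℕ)
    (hm : 4 ≤ m) (hmo : Odd m) (hn : 3 ≤ n) :
    2 * radioNumber ((SimpleGraph.pathGraph m) □ (⊤ : SimpleGraph (Fin n))) =
      m ^ 2 * n - 2 * m + n + 2 := by
  obtain ⟨k, rfl⟩ := hmo
  have hk : 2 ≤ k := by omega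
  obtain ⟨f, hf, hs⟩ := upper k n hk hn
  have h1 : radioNumber ((SimpleGraph.pathGraph (2 * k + 1)) □ (⊤ : SimpleGraph (Fin n)))
      ≤ spanOf f := Nat.sInf_le ⟨f, hf, rfl⟩
  have h2 : radioNumber ((SimpleGraph.pathGraph (2 * k + 1)) □ (⊤ : SimpleGraph (Fin n))) ∈
      { k' | ∃ g : Fin (2 * k + 1) × Fin n → ℕ, IsRadioLabelling
        ((SimpleGraph.pathGraph (2 * k + 1)) □ (⊤ : SimpleGraph (Fin n))) g ∧ spanOf g = k' } :=
    Nat.sInf_mem ⟨_, f, hf, rfl⟩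
  obtain ⟨g, hg, hgs⟩ := h2
  have h3 := lower k n hk hn g hg
  rw [hgs] at h3
  have e1 : (2 * k + 1) ^ 2 * n + n = 2 * (n * (2 * k ^ 2 + 2 * k + 1)) := by ring
  have e2 : 2 * (2 * k + 1) ≤ (2 * k + 1) ^ 2 * n := by nlinarith
  omega

end RadioPaper
end
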